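/- arXiv:1805.12529 — 4 statements merged into one kernel-verified Lean document; each statement's English description precedes it below -/
import Mathlib

section
/- Assume the generative model where in addition Z* has orthonormal rows, i.e. Z*(Z*)^T = Id (note this forces ‖P‖_2 = ‖Z*‖_2 = 1), and assume q := max_{1≤k≤n} ‖D_k Z* D̃_k‖_2 < 1. Then for every q̄ with q < q̄ < 1 there exists ε > 0 such that for every initial orthogonal matrix W^0 with ‖W^0 − W*‖_F ≤ ε, the iterates of the alternating algorithm satisfy, for all t ≥ 1: ‖Z^t − Z*‖_F ≤ q̄^{t−1} ε and ‖W^t − W*‖_F ≤ q̄^t ε. In particular the iterates converge linearly to the underlying model (Z*, W*). -/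
open Matrix MeasureTheory ProbabilityTheory Filter
open scoped Kronecker

noncomputable section

/-- Frobenius norm of a real matrix. -/
def frobNorm {m n : Type*} [Fintype m] [Fintype n] (M : Matrix m n ℝ) : ℝ :=
  Real.sqrt (∑ i, ∑ j, (M i j) ^ 2)

/-- Spectral norm (largest singular value) of a real matrix. -/
def specNorm {m n : Type*} [Fintype m] [Fintype n] [DecidableEq n] (M : Matrix m n ℝ) : ℝ :=
  ‖LinearMap.toContinuousLinearMap (Matrix.toEuclideanLin M)‖

/-- Smallest singular value of a real matrix (as the infimum of `‖Mᵀ x‖` over unit vectors). -/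
def sigmaMin {m n : Type*} [Fintype m] [Fintype n] [DecidableEq m] (M : Matrix m n ℝ) : ℝ :=
  sInf {c : ℝ | ∃ x : EuclideanSpace ℝ m, ‖x‖ = 1 ∧ c = ‖Matrix.toEuclideanLin Mᵀ x‖}

/-- Condition number: ratio of largest to smallest singular value. -/
def condNum {m n : Type*} [Fintype m] [Fintype n] [DecidableEq m] [DecidableEq n]
    (M : Matrix m n ℝ) : ℝ :=
  specNorm M / sigmaMin M

/-- `D_k`: diagonal matrix with ones on the diagonal except a zero at `(k,k)`. -/
def Dk {n : Type*} [Fintype n] [DecidableEq n] (k : n) : Matrix n n ℝ :=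
  Matrix.diagonal (fun i => if i = k then 0 else 1)

/-- `D̃_k`: diagonal matrix with ones at columns in the support of the `k`-th row of `Z`. -/
def Dtil {n N : Type*} [Fintype n] [Fintype N] [DecidableEq N]
    (Z : Matrix n N ℝ) (k : n) : Matrix N N ℝ :=
  Matrix.diagonal (fun j => if Z k j ≠ 0 then 1 else 0)

/-- `max_{1 ≤ k ≤ n} ‖D_k Z D̃_k‖₂`. -/
def qmax {n N : Type*} [Fintype n] [Fintype N] [DecidableEq n] [DecidableEq N]
    (Z : Matrix n N ℝ) : ℝ :=
  ⨆ k : n, specNorm (Dk k * Z * Dtil Z k)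

/-- `z = H_s(v)`: hard thresholding of `v` to its `s` largest-magnitude entries. -/
def IsHardThresh {n : ℕ} (s : ℕ) (v z : Fin n → ℝ) : Prop :=
  ∃ T : Finset (Fin n), T.card = s ∧ (∀ i ∈ T, ∀ j ∉ T, |v j| ≤ |v i|) ∧
    (∀ i ∈ T, z i = v i) ∧ (∀ i ∉ T, z i = 0)

/-- Euclidean norm of a vector. -/
def l2norm {n : ℕ} (v : Fin n → ℝ) : ℝ := Real.sqrt (∑ i, (v i) ^ 2)

/-- `β(v)`: smallest magnitude among the nonzero entries of `v`. -/
def betaMin {n : ℕ} (v : Fin n → ℝ) : ℝ :=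
  sInf {c : ℝ | ∃ i, v i ≠ 0 ∧ c = |v i|}

/-- The constant `C(ε₀)` from the convergence-radius analysis. -/
def Cconst (e : ℝ) : ℝ :=
  2 + 9 * Real.sqrt 2 / (8 * (1 - 2 * e - e ^ 2) ^ ((3 : ℝ) / 2)) + Real.sqrt 2 / (1 - e)

end

section FrobeniusGeometry

open scoped Matrix.Norms.Frobenius

variable {m n p : Type*} [Fintype m] [Fintype n] [Fintype p]

lemma frobNorm_eq_norm (M : Matrix m n ℝ) : frobNorm M = ‖M‖ := by
  rw [frobNorm, frobenius_norm_def, Real.sqrt_eq_rpow]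
  simp

lemma norm_sq_eq_sum (M : Matrix m n ℝ) : ‖M‖ ^ 2 = ∑ i, ∑ j, M i j ^ 2 := by
  rw [← frobNorm_eq_norm, frobNorm, Real.sq_sqrt (by positivity)]

lemma norm_sq_eq_trace (M : Matrix m n ℝ) : ‖M‖ ^ 2 = trace (Mᵀ * M) := by
  rw [norm_sq_eq_sum, Finset.sum_comm]
  simp [trace, mul_apply, sq]

lemma norm_sq_eq_trace_mul_transpose (M : Matrix m n ℝ) : ‖M‖ ^ 2 = trace (M * Mᵀ) := by
  rw [norm_sq_eq_trace, trace_mul_comm]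

lemma trace_transpose_mul_le (A B : Matrix m n ℝ) : trace (Aᵀ * B) ≤ ‖A‖ * ‖B‖ := by
  have h : trace (Aᵀ * B) = ∑ x : m × n, A x.1 x.2 * B x.1 x.2 := by
    rw [Fintype.sum_prod_type, Finset.sum_comm]
    simp [trace, mul_apply]
  have hA : ‖A‖ ^ 2 = ∑ x : m × n, A x.1 x.2 ^ 2 := by
    rw [norm_sq_eq_sum, Fintype.sum_prod_type]
  have hB : ‖B‖ ^ 2 = ∑ x : m × n, B x.1 x.2 ^ 2 := by
    rw [norm_sq_eq_sum, Fintype.sum_prod_type]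
  refine abs_le_of_sq_le_sq' ?_ (by positivity) |>.2
  rw [h, mul_pow, hA, hB]
  exact Finset.sum_mul_sq_le_sq_mul_sq _ _ _

lemma norm_orthogonal_mul [DecidableEq m] {U : Matrix m m ℝ} (hU : Uᵀ * U = 1)
    (M : Matrix m n ℝ) : ‖U * M‖ = ‖M‖ := by
  rw [← sq_eq_sq₀ (norm_nonneg _) (norm_nonneg _), norm_sq_eq_trace, norm_sq_eq_trace,
    transpose_mul, Matrix.mul_assoc, ← Matrix.mul_assoc _ U, hU, Matrix.one_mul]

lemma norm_mul_of_mul_transpose_eq_one [DecidableEq n] {Z : Matrix n p ℝ} (hZ : Z * Zᵀ = 1)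
    (M : Matrix m n ℝ) : ‖M * Z‖ = ‖M‖ := by
  rw [← sq_eq_sq₀ (norm_nonneg _) (norm_nonneg _), norm_sq_eq_trace_mul_transpose,
    norm_sq_eq_trace_mul_transpose, transpose_mul, Matrix.mul_assoc, ← Matrix.mul_assoc Z, hZ,
    Matrix.one_mul]

lemma norm_mul_transpose_le_of_mul_transpose_eq_one [DecidableEq n] {Z : Matrix n p ℝ}
    (hZ : Z * Zᵀ = 1) (M : Matrix m p ℝ) : ‖M * Zᵀ‖ ≤ ‖M‖ := by
  rw [← sq_le_sq₀ (norm_nonneg _) (norm_nonneg _)]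
  have h : ‖M - M * Zᵀ * Z‖ ^ 2 = ‖M‖ ^ 2 - ‖M * Zᵀ‖ ^ 2 := by
    have hproj : M * Zᵀ * Z * (M * Zᵀ * Z)ᵀ = M * Zᵀ * (M * Zᵀ)ᵀ := by
      rw [transpose_mul _ Z, Matrix.mul_assoc, ← Matrix.mul_assoc Z, hZ, Matrix.one_mul]
    have hleft : M * Zᵀ * Z * Mᵀ = M * Zᵀ * (M * Zᵀ)ᵀ := by
      rw [transpose_mul, transpose_transpose, Matrix.mul_assoc]
    have hright : M * (M * Zᵀ * Z)ᵀ = M * Zᵀ * (M * Zᵀ)ᵀ := by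
      simp only [transpose_mul, transpose_transpose, Matrix.mul_assoc]
    simp only [norm_sq_eq_trace_mul_transpose]
    rw [transpose_sub, Matrix.sub_mul, Matrix.mul_sub, Matrix.mul_sub, hproj, hleft, hright]
    simp
  nlinarith [sq_nonneg ‖M - M * Zᵀ * Z‖]

lemma abs_apply_le_norm (M : Matrix m n ℝ) (i : m) (j : n) : |M i j| ≤ ‖M‖ := by
  refine abs_le_of_sq_le_sq ?_ (norm_nonneg _)
  rw [norm_sq_eq_sum]
  calc M i j ^ 2 ≤ ∑ j, M i j ^ 2 :=
        Finset.single_le_sum (f := fun j => M i j ^ 2) (fun _ _ => sq_nonneg _) (Finset.mem_univ j)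
    _ ≤ _ := Finset.single_le_sum (f := fun i => ∑ j, M i j ^ 2) (fun _ _ => by positivity)
        (Finset.mem_univ i)

lemma norm_le_norm_of_abs_le {A B : Matrix m n ℝ} (h : ∀ i j, |A i j| ≤ |B i j|) :
    ‖A‖ ≤ ‖B‖ := by
  rw [← sq_le_sq₀ (norm_nonneg _) (norm_nonneg _), norm_sq_eq_sum, norm_sq_eq_sum]
  exact Finset.sum_le_sum fun i _ => Finset.sum_le_sum fun j _ => sq_le_sq.2 (h i j)

/-- A maximizer over the orthogonal group of a linear functional, translated to the identity,
is given by a symmetric matrix. -/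
lemma isSymm_of_trace_le [DecidableEq n] {M : Matrix n n ℝ}
    (hM : ∀ R : Matrix n n ℝ, Rᵀ * R = 1 → trace (Rᵀ * M) ≤ trace M) : Mᵀ = M := by
  ext i j
  rw [transpose_apply]
  by_cases hij : i = j
  · rw [hij]
  set K : Matrix n n ℝ := single i j 1 - single j i 1 with hK
  have hKT : Kᵀ = -K := by simp [hK]
  have hK3 : K * K * K = -K := by
    simp [hK, Matrix.mul_sub, Matrix.sub_mul, single_mul_single_of_ne, hij, Ne.symm hij]
    abel
  have htr : trace (K * M) = M j i - M i j := by
    simp [hK, Matrix.sub_mul, trace_single_mul]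
  have key : ∀ t : ℝ, t ^ 2 * trace (K * K * M) - t * trace (K * M) ≤ 0 := by
    intro t
    have ht : 0 < 1 + t ^ 2 := by positivity
    set a : ℝ := 2 * t ^ 2 / (1 + t ^ 2) with ha
    set b : ℝ := 2 * t / (1 + t ^ 2) with hb
    have hab : 2 * a - a ^ 2 - b ^ 2 = 0 := by
      rw [ha, hb]; field_simp; ring
    have hRT : (1 + a • (K * K) + b • K)ᵀ = 1 + a • (K * K) - b • K := by
      simp [hKT, sub_eq_add_neg]
    have hR : (1 + a • (K * K) + b • K)ᵀ * (1 + a • (K * K) + b • K) = 1 := by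
      have h3 : K * (K * K) = -K := by rw [← Matrix.mul_assoc, hK3]
      rw [hRT]
      have : (1 + a • (K * K) - b • K) * (1 + a • (K * K) + b • K)
          = 1 + (2 * a - a ^ 2 - b ^ 2) • (K * K) := by
        simp only [Matrix.mul_add, Matrix.add_mul, Matrix.sub_mul, Matrix.one_mul, Matrix.mul_one,
          Matrix.smul_mul, Matrix.mul_smul, Matrix.mul_assoc, Matrix.mul_neg, h3]
        module
      rw [this, hab]; simp
    have := hM _ hR
    rw [hRT] at this
    simp only [Matrix.add_mul, Matrix.sub_mul, trace_add, trace_sub, Matrix.one_mul,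
      Matrix.smul_mul, trace_smul, smul_eq_mul] at this
    have h2 : a * trace (K * K * M) - b * trace (K * M)
        = 2 / (1 + t ^ 2) * (t ^ 2 * trace (K * K * M) - t * trace (K * M)) := by
      rw [ha, hb]; ring
    by_contra! hcon
    have := mul_pos (show 0 < 2 / (1 + t ^ 2) by positivity) hcon
    linarith
  have hzero : trace (K * M) = 0 := by
    generalize trace (K * K * M) = c at key
    generalize trace (K * M) = d at key
    have h := key (-(d / (1 + |c|)))
    have hc : 0 < 1 + |c| := by positivity
    have h2 : (-(d / (1 + |c|))) ^ 2 * c - -(d / (1 + |c|)) * d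
        = (d / (1 + |c|)) ^ 2 * (c + (1 + |c|)) := by
      field_simp
      ring
    rw [h2] at h
    have h3 : 1 ≤ c + (1 + |c|) := by linarith [neg_abs_le c]
    have h4 : (d / (1 + |c|)) ^ 2 ≤ 0 := by nlinarith [sq_nonneg (d / (1 + |c|))]
    have h5 : d / (1 + |c|) = 0 := pow_eq_zero_iff two_ne_zero |>.1 (le_antisymm h4 (sq_nonneg _))
    rcases div_eq_zero_iff.1 h5 with h | h
    · exact h
    · exact absurd h hc.ne'
  linarith

lemma add_transpose_eq_neg_of_orthogonal [DecidableEq n] {Q : Matrix n n ℝ} (hQ : Qᵀ * Q = 1) :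
    (Q - 1) + (Q - 1)ᵀ = -((Q - 1)ᵀ * (Q - 1)) := by
  simp only [transpose_sub, transpose_one, Matrix.sub_mul, Matrix.mul_sub, hQ, Matrix.one_mul,
    Matrix.mul_one]
  abel

/-- First-order perturbation bound for the orthogonal polar factor near the identity. -/
lemma norm_polar_sub_one_le [DecidableEq n] {Q F : Matrix n n ℝ} (hQ : Qᵀ * Q = 1)
    (hmax : ∀ V : Matrix n n ℝ, Vᵀ * V = 1 → trace (Vᵀ * (1 + F)) ≤ trace (Qᵀ * (1 + F))) :
    ‖Q - 1‖ ≤ ‖F‖ + 4 * ‖F‖ ^ 2 := by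
  have hsymm : (Qᵀ * (1 + F))ᵀ = Qᵀ * (1 + F) := by
    refine isSymm_of_trace_le fun R hR => ?_
    rw [← Matrix.mul_assoc, ← transpose_mul]
    refine hmax _ ?_
    rw [transpose_mul, Matrix.mul_assoc, ← Matrix.mul_assoc _ Q, hQ, Matrix.one_mul, hR]
  have hquad := add_transpose_eq_neg_of_orthogonal hQ
  obtain ⟨G, hG⟩ : ∃ G, Q - 1 = G := ⟨_, rfl⟩
  obtain rfl : Q = 1 + G := by rw [← hG]; abel
  rw [hG] at hquad ⊢
  have hcoarse : ‖G‖ ≤ 2 * ‖F‖ := by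
    have h1 := hmax 1 (by simp)
    have h2 := trace_transpose_mul_le G F
    have h3 := congrArg trace hquad
    rw [trace_neg, ← norm_sq_eq_trace, trace_add, trace_transpose] at h3
    simp only [transpose_add, transpose_one, Matrix.add_mul, Matrix.mul_add, Matrix.one_mul,
      Matrix.mul_one, trace_add, trace_transpose] at h1
    by_contra! hcon
    have hGpos : 0 < ‖G‖ := lt_of_le_of_lt (by positivity) hcon
    nlinarith
  have hskew : G - Gᵀ = F - Fᵀ + (Gᵀ * F - Fᵀ * G) := by
    simp only [transpose_mul, transpose_add, transpose_one, transpose_transpose, Matrix.add_mul,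
      Matrix.mul_add, Matrix.one_mul, Matrix.mul_one] at hsymm
    rw [← sub_eq_zero] at hsymm ⊢
    rw [← hsymm]
    abel
  have h2G : (2 : ℝ) • G = F - Fᵀ + (Gᵀ * F - Fᵀ * G) - Gᵀ * G := by
    rw [← hskew, sub_eq_add_neg _ (Gᵀ * G), ← hquad, two_smul]
    abel
  have hGF : ‖Gᵀ * F‖ ≤ ‖G‖ * ‖F‖ := by
    simpa [frobenius_norm_transpose] using frobenius_norm_mul Gᵀ F
  have hFG : ‖Fᵀ * G‖ ≤ ‖G‖ * ‖F‖ := by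
    simpa [frobenius_norm_transpose, mul_comm] using frobenius_norm_mul Fᵀ G
  have hGG : ‖Gᵀ * G‖ ≤ ‖G‖ * ‖G‖ := by
    simpa [frobenius_norm_transpose] using frobenius_norm_mul Gᵀ G
  have hFF : ‖F - Fᵀ‖ ≤ 2 * ‖F‖ := by
    have := norm_sub_le F Fᵀ
    rw [frobenius_norm_transpose] at this
    linarith
  have h2 : 2 * ‖G‖ ≤ 2 * ‖F‖ + 2 * (‖G‖ * ‖F‖) + ‖G‖ * ‖G‖ := by
    have h := congrArg norm h2G
    rw [norm_smul, Real.norm_ofNat] at h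
    rw [h]
    have := norm_sub_le (F - Fᵀ + (Gᵀ * F - Fᵀ * G)) (Gᵀ * G)
    have := norm_add_le (F - Fᵀ) (Gᵀ * F - Fᵀ * G)
    have := norm_sub_le (Gᵀ * F) (Fᵀ * G)
    linarith
  nlinarith [norm_nonneg F, norm_nonneg G]

lemma norm_diagonal_diag_sub_one_le [DecidableEq n] {Q : Matrix n n ℝ} (hQ : Qᵀ * Q = 1) :
    ‖diagonal (Q - 1).diag‖ ≤ ‖Q - 1‖ ^ 2 / 2 := by
  have hquad := add_transpose_eq_neg_of_orthogonal hQ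
  set G := Q - 1
  have h1 : ‖diagonal G.diag‖ ≤ ‖(2⁻¹ : ℝ) • (Gᵀ * G)‖ := by
    refine norm_le_norm_of_abs_le fun i j => ?_
    by_cases hij : i = j
    · subst hij
      have := congrFun (congrFun hquad i) i
      rw [Matrix.add_apply, transpose_apply, Matrix.neg_apply] at this
      rw [diagonal_apply_eq, diag_apply, Matrix.smul_apply, smul_eq_mul,
        show G i i = -(2⁻¹ * (Gᵀ * G) i i) by linarith, abs_neg]
    · simp [diagonal_apply_ne _ hij]
  have h2 := frobenius_norm_mul Gᵀ G
  rw [frobenius_norm_transpose] at h2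
  rw [norm_smul, Real.norm_of_nonneg (by norm_num)] at h1
  linarith

end FrobeniusGeometry

section SpectralNorm

open scoped Matrix.Norms.L2Operator

lemma sum_vecMul_sq_le {m n : Type*} [Fintype m] [Fintype n] [DecidableEq m] [DecidableEq n]
    (M : Matrix m n ℝ) (x : m → ℝ) :
    ∑ j, (x ᵥ* M) j ^ 2 ≤ specNorm M ^ 2 * ∑ i, x i ^ 2 := by
  have h := l2_opNorm_mulVec Mᴴ (WithLp.toLp 2 x)
  rw [l2_opNorm_conjTranspose] at h
  have hM : ‖M‖ = specNorm M := rfl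
  rw [hM] at h
  have h2 := pow_le_pow_left₀ (norm_nonneg _) h 2
  rw [mul_pow, EuclideanSpace.norm_sq_eq, EuclideanSpace.norm_sq_eq] at h2
  simpa [mulVec_transpose] using h2

end SpectralNorm

lemma specNorm_nonneg {m n : Type*} [Fintype m] [Fintype n] [DecidableEq n]
    (M : Matrix m n ℝ) : 0 ≤ specNorm M := norm_nonneg _

lemma specNorm_le_qmax {n N : Type*} [Fintype n] [Fintype N] [DecidableEq n] [DecidableEq N]
    (Z : Matrix n N ℝ) (k : n) : specNorm (Dk k * Z * Dtil Z k) ≤ qmax Z :=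
  le_ciSup (f := fun k => specNorm (Dk k * Z * Dtil Z k)) (Set.finite_range _).bddAbove k

lemma qmax_nonneg {n N : Type*} [Fintype n] [Fintype N] [DecidableEq n] [DecidableEq N]
    (Z : Matrix n N ℝ) : 0 ≤ qmax Z :=
  Real.iSup_nonneg fun _ => specNorm_nonneg _

/-- Restriction of `M` to the support of `Z`. -/
noncomputable def maskBy {m n : Type*} (Z M : Matrix m n ℝ) : Matrix m n ℝ :=
  Matrix.of fun i j => if Z i j ≠ 0 then M i j else 0

section Contraction

open scoped Matrix.Norms.Frobenius

variable {n N : Type*} [Fintype n] [Fintype N]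

lemma norm_maskBy_le (Z M : Matrix n N ℝ) : ‖maskBy Z M‖ ≤ ‖M‖ := by
  refine norm_le_norm_of_abs_le fun i j => ?_
  simp only [maskBy, of_apply]
  split_ifs
  · exact le_rfl
  · simp

variable [DecidableEq n] [DecidableEq N]

lemma norm_maskBy_mul_le {Z : Matrix n N ℝ} (hZ : Z * Zᵀ = 1) (E : Matrix n n ℝ) :
    ‖maskBy Z (E * Z)‖ ≤ qmax Z * ‖E‖ + ‖diagonal E.diag‖ := by
  set B : Matrix n N ℝ := Matrix.of fun k => E k ᵥ* (Dk k * Z * Dtil Z k) with hB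
  have hsplit : maskBy Z (E * Z) = B + diagonal E.diag * Z := by
    ext k j
    have hBkj : B k j = if Z k j ≠ 0 then ∑ i, E k i * ((if i = k then 0 else 1) * Z i j) else 0 := by
      simp [hB, vecMul, dotProduct, Dk, Dtil, diagonal_mul, mul_diagonal]
    rw [Matrix.add_apply, hBkj, diagonal_mul, diag_apply, maskBy, of_apply]
    split_ifs with h
    · have : ∀ i, E k i * Z i j = E k i * ((if i = k then 0 else 1) * Z i j)
          + if i = k then E k i * Z i j else 0 := by
        intro i; split_ifs <;> simp
      rw [mul_apply, Finset.sum_congr rfl fun i _ => this i, Finset.sum_add_distrib]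
      simp
    · simp [not_not.1 h]
  have hBnorm : ‖B‖ ≤ qmax Z * ‖E‖ := by
    have hq := qmax_nonneg Z
    rw [← sq_le_sq₀ (norm_nonneg _) (by positivity), mul_pow, norm_sq_eq_sum, norm_sq_eq_sum, Finset.mul_sum]
    refine Finset.sum_le_sum fun k _ => (sum_vecMul_sq_le _ (E k)).trans ?_
    have := pow_le_pow_left₀ (specNorm_nonneg _) (specNorm_le_qmax Z k) 2
    gcongr
  rw [hsplit]
  refine (norm_add_le _ _).trans ?_
  rw [norm_mul_of_mul_transpose_eq_one hZ]
  linarith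

end Contraction

lemma IsHardThresh.eq_of_close {n s : ℕ} {v z w : Fin n → ℝ} {b : ℝ} (h : IsHardThresh s v z)
    (hcard : (Finset.univ.filter fun i => w i ≠ 0).card = s) (hb : ∀ i, w i ≠ 0 → b ≤ |w i|)
    (hv : ∀ i, |v i - w i| < b / 2) (i : Fin n) : z i = if w i ≠ 0 then v i else 0 := by
  obtain ⟨T, hT, hTmax, hz, hz0⟩ := h
  have hsub : (Finset.univ.filter fun i => w i ≠ 0) ⊆ T := by
    intro i hi
    by_contra hiT
    obtain ⟨k, hkT, hk⟩ : ∃ k ∈ T, k ∉ Finset.univ.filter fun i => w i ≠ 0 := by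
      by_contra! hcon
      have := Finset.eq_of_subset_of_card_le (s := T) hcon (by rw [hT, hcard])
      exact hiT (this ▸ hi)
    have hwi := hb i (by simpa using hi)
    have hwk : w k = 0 := by simpa using hk
    have h1 := hTmax k hkT i hiT
    have h2 := hv k
    have h3 := hv i
    rw [hwk, sub_zero] at h2
    have h4 := abs_sub_abs_le_abs_sub (w i) (v i)
    rw [abs_sub_comm] at h4
    linarith
  have hTeq := Finset.eq_of_subset_of_card_le hsub (by rw [hT, hcard])
  split_ifs with hi
  · exact hz i (hsub (by simpa using hi))
  · exact hz0 i (by rw [← hTeq]; simpa using hi)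

lemma exists_pos_le_abs_of_ne_zero {m n : Type*} [Finite m] [Finite n] (Z : Matrix m n ℝ) :
    ∃ b > 0, ∀ i j, Z i j ≠ 0 → b ≤ |Z i j| := by
  have hfin : {x : m × n | Z x.1 x.2 ≠ 0}.Finite := Set.toFinite _
  rcases Set.eq_empty_or_nonempty {x : m × n | Z x.1 x.2 ≠ 0} with h | h
  · refine ⟨1, one_pos, fun i j hij => ?_⟩
    have : (i, j) ∈ {x : m × n | Z x.1 x.2 ≠ 0} := hij
    simp [h] at this
  · obtain ⟨x, hx, hmin⟩ := Set.exists_min_image _ (fun x : m × n => |Z x.1 x.2|) hfin h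
    exact ⟨|Z x.1 x.2|, abs_pos.2 hx, fun i j hij => hmin (i, j) hij⟩

section Step

open scoped Matrix.Norms.Frobenius

/-- One sweep of the alternating algorithm, in the coordinates where the true dictionary is the
identity: `U` is the old iterate, `Q` the new one and `Y` the coefficients in between. -/
lemma alternating_step {n N s : ℕ} {Z Y : Matrix (Fin n) (Fin N) ℝ} {U Q : Matrix (Fin n) (Fin n) ℝ}
    {b qbar : ℝ} (hZ : Z * Zᵀ = 1)
    (hcols : ∀ j, (Finset.univ.filter (fun i => Z i j ≠ 0)).card = s)
    (hb : ∀ i j, Z i j ≠ 0 → b ≤ |Z i j|)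
    (hU : Uᵀ * U = 1) (hQ : Qᵀ * Q = 1)
    (hUb : ‖U - 1‖ < b / 2) (hUq : ‖U - 1‖ ≤ (qbar - qmax Z) / 5)
    (hY : ∀ j, IsHardThresh s (fun i => (U * Z) i j) (fun i => Y i j))
    (hopt : ∀ V : Matrix (Fin n) (Fin n) ℝ, Vᵀ * V = 1 → ‖Q * Z - Y‖ ≤ ‖V * Z - Y‖) :
    ‖Y - Z‖ ≤ ‖U - 1‖ ∧ ‖Q - 1‖ ≤ qbar * ‖U - 1‖ := by
  set E := U - 1 with hE
  have hEZ : U * Z = Z + E * Z := by rw [hE, Matrix.sub_mul, Matrix.one_mul]; abel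
  have hEnorm : ‖E * Z‖ = ‖E‖ := norm_mul_of_mul_transpose_eq_one hZ E
  have hYZ : Y - Z = maskBy Z (E * Z) := by
    ext i j
    have h := (hY j).eq_of_close (w := fun i => Z i j) (b := b) (hcols j) (fun i => hb i j)
      (fun i => by
        have := abs_apply_le_norm (E * Z) i j
        rw [hEZ, Matrix.add_apply, add_sub_cancel_left]
        linarith) i
    rw [Matrix.sub_apply, h, hEZ, Matrix.add_apply, maskBy, of_apply]
    split_ifs with h0
    · ring
    · simp [not_not.1 h0]
  have hYle : ‖Y - Z‖ ≤ ‖E‖ := by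
    rw [hYZ, ← hEnorm]; exact norm_maskBy_le _ _
  refine ⟨hYle, ?_⟩
  set F := (Y - Z) * Zᵀ with hF
  have hYF : Y * Zᵀ = 1 + F := by rw [hF, Matrix.sub_mul, hZ]; abel
  have hexpand : ∀ V : Matrix (Fin n) (Fin n) ℝ, Vᵀ * V = 1 →
      ‖V * Z - Y‖ ^ 2 = ‖Z‖ ^ 2 + ‖Y‖ ^ 2 - 2 * trace (Vᵀ * (1 + F)) := by
    intro V hV
    have h1 : trace ((V * Z)ᵀ * Y) = trace (Vᵀ * (1 + F)) := by
      rw [← hYF, transpose_mul, Matrix.mul_assoc, trace_mul_comm, Matrix.mul_assoc]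
    have h2 : trace (Yᵀ * (V * Z)) = trace (Vᵀ * (1 + F)) := by
      rw [← h1, ← trace_transpose, transpose_mul, transpose_transpose]
    rw [norm_sq_eq_trace, transpose_sub, Matrix.sub_mul, Matrix.mul_sub, Matrix.mul_sub,
      trace_sub, trace_sub, trace_sub, h1, h2, ← norm_sq_eq_trace, ← norm_sq_eq_trace,
      norm_orthogonal_mul hV]
    ring
  have hpolar : ‖Q - 1‖ ≤ ‖F‖ + 4 * ‖F‖ ^ 2 := by
    refine norm_polar_sub_one_le hQ fun V hV => ?_
    have := pow_le_pow_left₀ (norm_nonneg _) (hopt V hV) 2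
    rw [hexpand V hV, hexpand Q hQ] at this
    linarith
  have hFY : ‖F‖ ≤ ‖Y - Z‖ := norm_mul_transpose_le_of_mul_transpose_eq_one hZ _
  have hFq : ‖F‖ ≤ qmax Z * ‖E‖ + ‖E‖ ^ 2 / 2 := by
    have h1 := norm_maskBy_mul_le hZ E
    rw [← hYZ] at h1
    have h2 := norm_diagonal_diag_sub_one_le hU
    linarith
  have hF2 : ‖F‖ ^ 2 ≤ ‖E‖ ^ 2 := pow_le_pow_left₀ (norm_nonneg _) (hFY.trans hYle) 2
  nlinarith [norm_nonneg E]

end Step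

/-- linear convergence of the alternating algorithm under the generative
model with orthonormal coefficient rows. -/
theorem stmt0 (n N s : ℕ) (hs : 1 ≤ s) (hsn : s ≤ n)
    (Wstar : Matrix (Fin n) (Fin n) ℝ) (Zstar P : Matrix (Fin n) (Fin N) ℝ)
    (hWorth : Wstarᵀ * Wstar = 1)
    (hP : P = Wstarᵀ * Zstar)
    (hPnorm : specNorm P = 1)
    (hcols : ∀ j, (Finset.univ.filter (fun i => Zstar i j ≠ 0)).card = s)
    (hrows : Zstar * Zstarᵀ = 1)
    (hq : qmax Zstar < 1) :
    ∀ qbar : ℝ, qmax Zstar < qbar → qbar < 1 →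
      ∃ ε > 0, ∀ W0 : Matrix (Fin n) (Fin n) ℝ,
        W0ᵀ * W0 = 1 → frobNorm (W0 - Wstar) ≤ ε →
        ∀ (Zs : ℕ → Matrix (Fin n) (Fin N) ℝ) (Ws : ℕ → Matrix (Fin n) (Fin n) ℝ),
          Ws 0 = W0 →
          (∀ t j, IsHardThresh s (fun i => (Ws t * P) i j) (fun i => Zs (t + 1) i j)) →
          (∀ t, (Ws (t + 1))ᵀ * Ws (t + 1) = 1 ∧
            ∀ W' : Matrix (Fin n) (Fin n) ℝ, W'ᵀ * W' = 1 →
              frobNorm (Ws (t + 1) * P - Zs (t + 1)) ≤ frobNorm (W' * P - Zs (t + 1))) →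
          ∀ t : ℕ, frobNorm (Zs (t + 1) - Zstar) ≤ qbar ^ t * ε ∧
            frobNorm (Ws (t + 1) - Wstar) ≤ qbar ^ (t + 1) * ε := by
  intro qbar hqbar hqbar1
  obtain ⟨b, hb0, hb⟩ := exists_pos_le_abs_of_ne_zero Zstar
  have hWorth' : Wstar * Wstarᵀ = 1 := mul_eq_one_comm.1 hWorth
  have hqbar0 : 0 < qbar := (qmax_nonneg Zstar).trans_lt hqbar
  refine ⟨min (b / 3) ((qbar - qmax Zstar) / 5), lt_min (by linarith) (by linarith), ?_⟩
  set ε := min (b / 3) ((qbar - qmax Zstar) / 5) with hε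
  have hε0 : 0 < ε := lt_min (by linarith) (by linarith)
  intro W0 hW0 hW0ε Zs Ws hWs0 hZs hWs
  have horth : ∀ t, (Ws t)ᵀ * Ws t = 1 := by
    intro t
    cases t with
    | zero => rw [hWs0, hW0]
    | succ t => exact (hWs t).1
  have htrans : ∀ {V : Matrix (Fin n) (Fin n) ℝ}, Vᵀ * V = 1 →
      (V * Wstarᵀ)ᵀ * (V * Wstarᵀ) = 1 := by
    intro V hV
    rw [transpose_mul, transpose_transpose, Matrix.mul_assoc, ← Matrix.mul_assoc _ V, hV,
      Matrix.one_mul, hWorth']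
  have hdist : ∀ V : Matrix (Fin n) (Fin n) ℝ,
      frobNorm (V * Wstarᵀ - 1) = frobNorm (V - Wstar) := by
    intro V
    rw [frobNorm_eq_norm, frobNorm_eq_norm, ← hWorth', ← Matrix.sub_mul]
    exact norm_mul_of_mul_transpose_eq_one (by rw [transpose_transpose, hWorth]) _
  have hstep : ∀ t, frobNorm (Ws t - Wstar) ≤ ε →
      frobNorm (Zs (t + 1) - Zstar) ≤ frobNorm (Ws t - Wstar) ∧
        frobNorm (Ws (t + 1) - Wstar) ≤ qbar * frobNorm (Ws t - Wstar) := by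
    intro t ht
    have h1 : ε ≤ b / 3 := min_le_left _ _
    have h2 : ε ≤ (qbar - qmax Zstar) / 5 := min_le_right _ _
    rw [← hdist, ← hdist]
    rw [← hdist] at ht
    simp only [frobNorm_eq_norm] at ht ⊢
    refine alternating_step hrows hcols hb (htrans (horth t)) (htrans (horth (t + 1)))
      (by linarith) (by linarith) ?_ fun V hV => ?_
    · simpa only [hP, Matrix.mul_assoc] using hZs t
    · have h := (hWs t).2 (V * Wstar) (by
        rw [transpose_mul, Matrix.mul_assoc, ← Matrix.mul_assoc _ V, hV, Matrix.one_mul, hWorth])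
      rw [frobNorm_eq_norm, frobNorm_eq_norm, hP, ← Matrix.mul_assoc, ← Matrix.mul_assoc,
        Matrix.mul_assoc V, hWorth', Matrix.mul_one] at h
      exact h
  have hdecay : ∀ t, frobNorm (Ws t - Wstar) ≤ qbar ^ t * ε := by
    intro t
    induction t with
    | zero => simpa [hWs0] using hW0ε
    | succ t ih =>
      have hpow : qbar ^ t * ε ≤ ε :=
        mul_le_of_le_one_left hε0.le (pow_le_one₀ hqbar0.le hqbar1.le)
      calc frobNorm (Ws (t + 1) - Wstar) ≤ qbar * frobNorm (Ws t - Wstar) :=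
            (hstep t (ih.trans hpow)).2
        _ ≤ qbar * (qbar ^ t * ε) := by gcongr
        _ = qbar ^ (t + 1) * ε := by ring
  intro t
  have hpow : qbar ^ t * ε ≤ ε :=
    mul_le_of_le_one_left hε0.le (pow_le_one₀ hqbar0.le hqbar1.le)
  exact ⟨(hstep t ((hdecay t).trans hpow)).1.trans (hdecay t), hdecay (t + 1)⟩
end

section
/- Let Z* ∈ ℝ^{n×N} have orthonormal rows (Z*(Z*)^T = Id), suppose every column of Z* has exactly 2 nonzero entries, and suppose that for all i ≠ k the support of the i-th row of Z* is not contained in the support of the k-th row of Z*. Then max_{1≤k≤n} ‖D_k Z* D̃_k‖_2 < 1. -/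
open Matrix MeasureTheory ProbabilityTheory Filter
open scoped Kronecker

/-- A matrix whose columns have at most one nonzero entry and whose rows have Euclidean norm
less than one has spectral norm less than one. -/
theorem specNorm_lt_one_of_disjoint_rows {m n : Type*} [Fintype m] [Fintype n] [DecidableEq n]
    (M : Matrix m n ℝ) (hdisj : ∀ j i i', M i j ≠ 0 → M i' j ≠ 0 → i = i')
    (hrow : ∀ i, ∑ j, M i j ^ 2 < 1) : specNorm M < 1 := by
  classical
  obtain ⟨c, hc, hc0, hc1⟩ : ∃ c : ℝ, (∀ i, ∑ j, M i j ^ 2 < c) ∧ 0 < c ∧ c < 1 := by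
    have h : ∀ᶠ c in nhdsWithin (1 : ℝ) (Set.Iio 1), ∀ i, ∑ j, M i j ^ 2 < c :=
      eventually_all.2 fun i => mem_of_superset (Ioo_mem_nhdsLT (hrow i)) fun _ hx => hx.1
    have h' : ∀ᶠ c in nhdsWithin (1 : ℝ) (Set.Iio 1), c ∈ Set.Ioo (0 : ℝ) 1 :=
      Ioo_mem_nhdsLT one_pos
    obtain ⟨c, h1, h2⟩ := (h.and h').exists
    exact ⟨c, h1, h2⟩
  have hbound : specNorm M ≤ √c := by
    refine ContinuousLinearMap.opNorm_le_bound _ (Real.sqrt_nonneg c) fun x => ?_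
    refine (sq_le_sq₀ (norm_nonneg _) (by positivity)).1 ?_
    rw [mul_pow, Real.sq_sqrt hc0.le, EuclideanSpace.real_norm_sq_eq,
      EuclideanSpace.real_norm_sq_eq]
    calc ∑ i, (∑ j, M i j * x j) ^ 2
        ≤ ∑ i, c * ∑ j, (if M i j ≠ 0 then x j else 0) ^ 2 := by
          refine Finset.sum_le_sum fun i _ => ?_
          have hmask : ∑ j, M i j * x j = ∑ j, M i j * (if M i j ≠ 0 then x j else 0) :=
            Finset.sum_congr rfl fun j _ => by by_cases h : M i j = 0 <;> simp [h]
          rw [hmask]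
          refine (Finset.sum_mul_sq_le_sq_mul_sq _ _ _).trans ?_
          exact mul_le_mul_of_nonneg_right (hc i).le (Finset.sum_nonneg fun _ _ => sq_nonneg _)
      _ = c * ∑ j, ∑ i, (if M i j ≠ 0 then x j else 0) ^ 2 := by
          rw [← Finset.mul_sum, Finset.sum_comm]
      _ ≤ c * ∑ j, x j ^ 2 := by
          refine mul_le_mul_of_nonneg_left (Finset.sum_le_sum fun j _ => ?_) hc0.le
          by_cases hj : ∃ i, M i j ≠ 0
          · obtain ⟨i, hi⟩ := hj
            rw [Finset.sum_eq_single i]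
            · simp [hi]
            · intro i' _ hne
              have : M i' j = 0 := by
                by_contra h
                exact hne (hdisj j i' i h hi)
              simp [this]
            · simp
          · push Not at hj
            simp [hj, sq_nonneg]
  exact hbound.trans_lt ((Real.sqrt_lt_sqrt hc0.le hc1).trans_eq Real.sqrt_one)

/-- The entries of `D_k Z D̃_k`. -/
theorem Dk_mul_mul_Dtil_apply {n N : Type*} [Fintype n] [Fintype N] [DecidableEq n]
    [DecidableEq N] (Z : Matrix n N ℝ) (k i : n) (j : N) :
    (Dk k * Z * Dtil Z k) i j = if i ≠ k ∧ Z k j ≠ 0 then Z i j else 0 := by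
  by_cases hi : i = k <;> by_cases hj : Z k j = 0 <;> simp [Dk, Dtil, hi, hj]

/-- for `s = 2` with orthonormal rows and no row support contained in
another, the contraction factor is `< 1`. -/
theorem stmt3 (n N : ℕ) (Zstar : Matrix (Fin n) (Fin N) ℝ)
    (hrows : Zstar * Zstarᵀ = 1)
    (hcols : ∀ j, (Finset.univ.filter (fun i => Zstar i j ≠ 0)).card = 2)
    (hsupp : ∀ i k : Fin n, i ≠ k →
      ¬ ({j : Fin N | Zstar i j ≠ 0} ⊆ {j : Fin N | Zstar k j ≠ 0})) :
    qmax Zstar < 1 := by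
  rcases isEmpty_or_nonempty (Fin n) with hn | hn
  · simp [qmax]
  obtain ⟨k, hk⟩ := exists_eq_ciSup_of_finite
    (f := fun k : Fin n => specNorm (Dk k * Zstar * Dtil Zstar k))
  rw [qmax, ← hk]
  apply specNorm_lt_one_of_disjoint_rows
  · intro j i i' hi hi'
    simp only [Dk_mul_mul_Dtil_apply, ne_eq, ite_eq_right_iff, not_forall] at hi hi'
    obtain ⟨⟨hik, hkj⟩, hij⟩ := hi
    obtain ⟨⟨hik', -⟩, hij'⟩ := hi'
    by_contra hne
    have hthree : ({i, i', k} : Finset (Fin n)).card = 3 :=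
      Finset.card_eq_three.2 ⟨i, i', k, hne, hik, hik', rfl⟩
    have hle : ({i, i', k} : Finset (Fin n)).card ≤ 2 := by
      rw [← hcols j]
      refine Finset.card_le_card fun a ha => ?_
      simp only [Finset.mem_insert, Finset.mem_singleton] at ha
      rcases ha with rfl | rfl | rfl <;> simpa
    omega
  · intro i
    simp only [Dk_mul_mul_Dtil_apply]
    rcases eq_or_ne i k with rfl | hik
    · simp
    have hnorm : ∑ j, Zstar i j ^ 2 = 1 := by
      have h := congrFun (congrFun hrows i) i
      simpa [Matrix.mul_apply, ← sq] using h
    obtain ⟨j, hj, hkj⟩ := Set.not_subset.1 (hsupp i k hik)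
    simp only [Set.mem_ofPred_eq, ne_eq, not_not] at hj hkj
    rw [← hnorm]
    refine Finset.sum_lt_sum (fun j _ => ?_) ⟨j, Finset.mem_univ j, ?_⟩
    · split_ifs
      · exact le_rfl
      · simpa using sq_nonneg (Zstar i j)
    · simpa [hkj] using pow_pos (abs_pos.2 hj) 2
end

section
/- Let Z* ∈ ℝ^{n×N} have full row rank and suppose every column of Z* has exactly 2 nonzero entries. If for all i ≠ k one has (Σ_{l ∈ S(Z*_{(i,·)}) ∩ S(Z*_{(k,·)})} (Z*_{(i,l)})²)^{1/2} < κ(Z*)^{−4}, then κ(Z*)^4 · max_{1≤k≤n} ‖D_k Z* D̃_k‖_2 < 1. -/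
open Matrix MeasureTheory ProbabilityTheory Filter
open scoped Kronecker

/-- A matrix whose columns each have at most one nonzero entry has spectral norm bounded by
any bound on the Euclidean norms of its rows. -/
theorem specNorm_le_of_column_subsingleton {m n : Type*} [Fintype m] [Fintype n] [DecidableEq n]
    (M : Matrix m n ℝ) (hM : ∀ j i i', M i j ≠ 0 → M i' j ≠ 0 → i = i')
    {b : ℝ} (hb : 0 ≤ b) (hrow : ∀ i, Real.sqrt (∑ j, M i j ^ 2) ≤ b) :
    specNorm M ≤ b := by
  classical
  refine ContinuousLinearMap.opNorm_le_bound _ hb fun x => ?_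
  refine (sq_le_sq₀ (norm_nonneg _) (by positivity)).1 ?_
  have hrow' : ∀ i, ∑ j, M i j ^ 2 ≤ b ^ 2 := fun i => (Real.sqrt_le_left hb).1 (hrow i)
  have hx : ∀ i, (∑ j, M i j * x j) ^ 2 ≤ b ^ 2 * ∑ j, if M i j ≠ 0 then x j ^ 2 else 0 := by
    intro i
    have h₁ : ∑ j, M i j * x j = ∑ j, M i j * (if M i j ≠ 0 then x j else 0) :=
      Finset.sum_congr rfl fun j _ => by by_cases h : M i j = 0 <;> simp [h]
    have h₂ : ∑ j, (if M i j ≠ 0 then x j else 0) ^ 2 = ∑ j, if M i j ≠ 0 then x j ^ 2 else 0 :=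
      Finset.sum_congr rfl fun j _ => by by_cases h : M i j = 0 <;> simp [h]
    rw [h₁, ← h₂]
    exact (Finset.sum_mul_sq_le_sq_mul_sq _ _ _).trans
      (mul_le_mul_of_nonneg_right (hrow' i) (Finset.sum_nonneg fun j _ => sq_nonneg _))
  rw [mul_pow, EuclideanSpace.norm_sq_eq, EuclideanSpace.norm_sq_eq]
  calc ∑ i, ‖(LinearMap.toContinuousLinearMap (Matrix.toEuclideanLin M)) x i‖ ^ 2
      = ∑ i, (∑ j, M i j * x j) ^ 2 := by
        simp [Matrix.toLpLin_apply, Matrix.mulVec, dotProduct]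
    _ ≤ ∑ i, b ^ 2 * ∑ j, (if M i j ≠ 0 then x j ^ 2 else 0) := Finset.sum_le_sum fun i _ => hx i
    _ = b ^ 2 * ∑ j, ∑ i, (if M i j ≠ 0 then x j ^ 2 else 0) := by
        rw [← Finset.mul_sum, Finset.sum_comm]
    _ ≤ b ^ 2 * ∑ j, ‖x j‖ ^ 2 := by
        refine mul_le_mul_of_nonneg_left (Finset.sum_le_sum fun j _ => ?_) (sq_nonneg b)
        have hcard : (Finset.univ.filter fun i => M i j ≠ 0).card ≤ 1 :=
          Finset.card_le_one.2 fun i hi i' hi' => hM j i i' (by simpa using hi) (by simpa using hi')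
        rw [← Finset.sum_filter, Finset.sum_const, nsmul_eq_mul, Real.norm_eq_abs, sq_abs]
        exact mul_le_of_le_one_left (sq_nonneg _) (by exact_mod_cast hcard)

theorem Dk_mul_mul_Dtil_column_subsingleton {n N : Type*} [Fintype n] [Fintype N]
    [DecidableEq n] [DecidableEq N] (Z : Matrix n N ℝ)
    (hcols : ∀ j, (Finset.univ.filter (fun i => Z i j ≠ 0)).card = 2) (k : n) (j : N) (i i' : n)
    (hi : (Dk k * Z * Dtil Z k) i j ≠ 0) (hi' : (Dk k * Z * Dtil Z k) i' j ≠ 0) : i = i' := by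
  simp only [Dk_mul_mul_Dtil_apply, ne_eq, ite_eq_right_iff, Classical.not_imp] at hi hi'
  by_contra hne
  have hsub : ({i, i', k} : Finset n) ⊆ Finset.univ.filter (fun i => Z i j ≠ 0) := by
    intro a ha
    simp only [Finset.mem_insert, Finset.mem_singleton] at ha
    rcases ha with rfl | rfl | rfl
    · simpa using hi.2
    · simpa using hi'.2
    · simpa using hi.1.2
  have hle := Finset.card_le_card hsub
  rw [hcols j, Finset.card_eq_three.2 ⟨i, i', k, hne, hi.1.1, hi'.1.1, rfl⟩] at hle
  omega


/-- for `s = 2` with full row rank, a quantitative overlap condition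
ensures the contraction factor is `< 1`. -/
theorem stmt4 (n N : ℕ) (Zstar : Matrix (Fin n) (Fin N) ℝ)
    (hrank : Zstar.rank = n)
    (hcols : ∀ j, (Finset.univ.filter (fun i => Zstar i j ≠ 0)).card = 2)
    (hsmall : ∀ i k : Fin n, i ≠ k →
      Real.sqrt (∑ l ∈ Finset.univ.filter (fun l => Zstar i l ≠ 0 ∧ Zstar k l ≠ 0),
          (Zstar i l) ^ 2) < (condNum Zstar ^ 4)⁻¹) :
    condNum Zstar ^ 4 * qmax Zstar < 1 := by
  obtain h₀ | hpos := (by positivity : 0 ≤ condNum Zstar ^ 4).eq_or_lt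
  · simp [← h₀]
  rcases isEmpty_or_nonempty (Fin n) with hn | hn
  · simp [qmax]
  obtain ⟨k, hk⟩ := exists_eq_ciSup_of_finite (f := fun k => specNorm (Dk k * Zstar * Dtil Zstar k))
  obtain ⟨i, hi⟩ := Finite.exists_max
    fun i => Real.sqrt (∑ j, (Dk k * Zstar * Dtil Zstar k) i j ^ 2)
  have hspec := specNorm_le_of_column_subsingleton _
    (Dk_mul_mul_Dtil_column_subsingleton Zstar hcols k) (Real.sqrt_nonneg _) hi
  have hrow : Real.sqrt (∑ j, (Dk k * Zstar * Dtil Zstar k) i j ^ 2) < (condNum Zstar ^ 4)⁻¹ := by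
    by_cases hik : i = k
    · simpa [Dk_mul_mul_Dtil_apply, hik] using hpos
    · convert hsmall i k hik using 2
      rw [Finset.sum_filter]
      refine Finset.sum_congr rfl fun j _ => ?_
      by_cases h₁ : Zstar i j = 0 <;> by_cases h₂ : Zstar k j = 0 <;>
        simp [Dk_mul_mul_Dtil_apply, hik, h₁, h₂]
  rw [qmax, ← hk, ← lt_inv_mul_iff₀ hpos, mul_one]
  exact hspec.trans_lt hrow
end

section
/- Assume the generative model. Let W^0 ∈ ℝ^{n×n} satisfy ‖W^0 − W*‖_F < ½ min_{1≤j≤N} β(Z*_{(·,j)} / ‖Z*_{(·,j)}‖_2), and let Z^1 ∈ ℝ^{n×N} have columns Z^1_{(·,j)} = H_s(W^0 P_{(·,j)}). Then for every j the support of Z^1_{(·,j)} equals the support of Z*_{(·,j)}, and ‖Z^1 − Z*‖_F ≤ ‖W^0 − W*‖_F. -/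
open Matrix MeasureTheory ProbabilityTheory Filter
open scoped Kronecker

lemma frobNorm_sq {m n : Type*} [Fintype m] [Fintype n] (M : Matrix m n ℝ) :
    frobNorm M ^ 2 = ∑ i, ∑ j, (M i j) ^ 2 :=
  Real.sq_sqrt (by positivity)

lemma l2norm_sq {n : ℕ} (v : Fin n → ℝ) : l2norm v ^ 2 = ∑ i, (v i) ^ 2 :=
  Real.sq_sqrt (by positivity)

lemma frobNorm_nonneg {m n : Type*} [Fintype m] [Fintype n] (M : Matrix m n ℝ) :
    0 ≤ frobNorm M := Real.sqrt_nonneg _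

lemma l2norm_nonneg {n : ℕ} (v : Fin n → ℝ) : 0 ≤ l2norm v := Real.sqrt_nonneg _

lemma l2norm_pos {n : ℕ} {v : Fin n → ℝ} {i : Fin n} (hi : v i ≠ 0) : 0 < l2norm v :=
  Real.sqrt_pos.2 (Finset.sum_pos' (fun _ _ => sq_nonneg _) ⟨i, Finset.mem_univ i, by positivity⟩)

lemma betaMin_le {n : ℕ} {v : Fin n → ℝ} {i : Fin n} (hi : v i ≠ 0) : betaMin v ≤ |v i| :=
  csInf_le ⟨0, by rintro _ ⟨k, -, rfl⟩; exact abs_nonneg _⟩ ⟨i, hi, rfl⟩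

section

open scoped Matrix.Norms.L2Operator

lemma specNorm_eq_l2_opNorm {m n : Type*} [Fintype m] [Fintype n] [DecidableEq n]
    (M : Matrix m n ℝ) : specNorm M = ‖M‖ := rfl

/-- The transpose of `M` expands Euclidean length by at most the spectral norm of `M`. -/
lemma sum_sq_vecMul_le {m n : Type*} [Fintype m] [Fintype n] [DecidableEq m] [DecidableEq n]
    (M : Matrix m n ℝ) (x : m → ℝ) :
    ∑ j, ((x ᵥ* M) j) ^ 2 ≤ specNorm M ^ 2 * ∑ i, (x i) ^ 2 := by
  have h := Matrix.l2_opNorm_mulVec Mᴴ (WithLp.toLp 2 x)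
  rw [Matrix.l2_opNorm_conjTranspose, ← specNorm_eq_l2_opNorm] at h
  have h2 := pow_le_pow_left₀ (norm_nonneg _) h 2
  rw [mul_pow, EuclideanSpace.norm_sq_eq, EuclideanSpace.norm_sq_eq] at h2
  simpa [Matrix.conjTranspose_eq_transpose_of_trivial, Matrix.mulVec_transpose] using h2

end

lemma frobNorm_mul_le {l m n : Type*} [Fintype l] [Fintype m] [Fintype n] [DecidableEq m]
    [DecidableEq n] (A : Matrix l m ℝ) (B : Matrix m n ℝ) :
    frobNorm (A * B) ≤ frobNorm A * specNorm B := by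
  refine (sq_le_sq₀ (frobNorm_nonneg _) (mul_nonneg (frobNorm_nonneg _) (norm_nonneg _))).1 ?_
  rw [mul_pow, frobNorm_sq, frobNorm_sq, Finset.sum_mul]
  refine Finset.sum_le_sum fun i _ => ?_
  rw [mul_comm]
  exact sum_sq_vecMul_le B (A i)

lemma frobNorm_mono {m n : Type*} [Fintype m] [Fintype n] {A B : Matrix m n ℝ}
    (h : ∀ i j, |A i j| ≤ |B i j|) : frobNorm A ≤ frobNorm B :=
  Real.sqrt_le_sqrt (Finset.sum_le_sum fun i _ => Finset.sum_le_sum fun j _ => sq_le_sq.2 (h i j))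

lemma abs_mul_apply_le {m n N : ℕ} (A : Matrix (Fin m) (Fin n) ℝ) (B : Matrix (Fin n) (Fin N) ℝ)
    (i : Fin m) (j : Fin N) : |(A * B) i j| ≤ frobNorm A * l2norm (fun k => B k j) := by
  refine abs_le_of_sq_le_sq ?_ (mul_nonneg (frobNorm_nonneg _) (l2norm_nonneg _))
  rw [mul_pow, frobNorm_sq, l2norm_sq, Matrix.mul_apply]
  refine (Finset.sum_mul_sq_le_sq_mul_sq _ _ _).trans ?_
  gcongr
  exact Finset.single_le_sum (f := fun i => ∑ k, A i k ^ 2)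
    (fun _ _ => by positivity) (Finset.mem_univ i)

lemma l2norm_col_transpose_mul {n N : ℕ} {W : Matrix (Fin n) (Fin n) ℝ} (hW : Wᵀ * W = 1)
    (Z : Matrix (Fin n) (Fin N) ℝ) (j : Fin N) :
    l2norm (fun i => (Wᵀ * Z) i j) = l2norm (fun i => Z i j) := by
  have h : (Wᵀ * Z)ᵀ * (Wᵀ * Z) = Zᵀ * Z := by
    rw [Matrix.transpose_mul, Matrix.transpose_transpose, Matrix.mul_assoc, ← Matrix.mul_assoc W,
      mul_eq_one_comm.1 hW, Matrix.one_mul]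
  have hcol := congr_fun (congr_fun h j) j
  simp only [Matrix.mul_apply (M := (_ : Matrix (Fin N) (Fin n) ℝ)), Matrix.transpose_apply,
    ← sq] at hcol
  exact congr_arg Real.sqrt hcol

/-- If `v` is larger on a set `S` of size `s` than off `S`, then hard thresholding keeps `S`. -/
lemma IsHardThresh.eq_of_separated {n s : ℕ} {v z : Fin n → ℝ} (h : IsHardThresh s v z)
    {S : Finset (Fin n)} (hS : S.card = s) (hsep : ∀ i ∈ S, ∀ k ∉ S, |v k| < |v i|) :
    (∀ i ∈ S, z i = v i) ∧ ∀ i ∉ S, z i = 0 := by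
  obtain ⟨T, hT, hTv, hz, hz0⟩ := h
  have hsub : S ⊆ T := by
    intro i hi
    by_contra hiT
    have hTS : ¬ T ⊆ S := fun hTS =>
      hiT (Finset.eq_of_subset_of_card_le hTS (by rw [hS, hT]) ▸ hi)
    obtain ⟨k, hkT, hkS⟩ := Finset.not_subset.1 hTS
    exact (hsep i hi k hkS).not_ge (hTv k hkT i hiT)
  obtain rfl := Finset.eq_of_subset_of_card_le hsub (by rw [hS, hT])
  exact ⟨hz, hz0⟩

/-- support recovery and the sparse-coding error bound for one
sparse-coding step, under an `ε`-close (not necessarily orthogonal) initialization. -/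
theorem stmt6 (n N s : ℕ) (hs : 1 ≤ s) (hsn : s ≤ n)
    (Wstar : Matrix (Fin n) (Fin n) ℝ) (Zstar P : Matrix (Fin n) (Fin N) ℝ)
    (hWorth : Wstarᵀ * Wstar = 1)
    (hP : P = Wstarᵀ * Zstar)
    (hPnorm : specNorm P = 1)
    (hcols : ∀ j, (Finset.univ.filter (fun i => Zstar i j ≠ 0)).card = s)
    (W0 : Matrix (Fin n) (Fin n) ℝ)
    (hW0 : frobNorm (W0 - Wstar) < (1 / 2) * ⨅ j : Fin N,
      betaMin (fun i => Zstar i j / l2norm (fun i => Zstar i j)))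
    (Z1 : Matrix (Fin n) (Fin N) ℝ)
    (hZ1 : ∀ j, IsHardThresh s (fun i => (W0 * P) i j) (fun i => Z1 i j)) :
    (∀ j : Fin N, {i : Fin n | Z1 i j ≠ 0} = {i : Fin n | Zstar i j ≠ 0}) ∧
    frobNorm (Z1 - Zstar) ≤ frobNorm (W0 - Wstar) := by
  have hmul : ∀ i j, (W0 * P) i j = Zstar i j + ((W0 - Wstar) * P) i j := by
    intro i j
    have : Wstar * P = Zstar := by
      rw [hP, ← Matrix.mul_assoc, mul_eq_one_comm.1 hWorth, Matrix.one_mul]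
    rw [Matrix.sub_mul, this, Matrix.sub_apply]
    ring
  have herr : ∀ i j, |((W0 - Wstar) * P) i j| ≤
      frobNorm (W0 - Wstar) * l2norm (fun i => Zstar i j) := by
    intro i j
    rw [← l2norm_col_transpose_mul hWorth, ← hP]
    exact abs_mul_apply_le _ _ i j
  have hbig : ∀ i j, Zstar i j ≠ 0 →
      frobNorm (W0 - Wstar) * l2norm (fun i => Zstar i j) < |(W0 * P) i j| := by
    intro i j hij
    have hpos : 0 < l2norm (fun i => Zstar i j) := l2norm_pos (v := fun i => Zstar i j) hij
    have h1 := (ciInf_le (Set.finite_range fun j : Fin N =>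
      betaMin (fun i => Zstar i j / l2norm (fun i => Zstar i j))).bddBelow j).trans
      (betaMin_le (i := i) (div_ne_zero hij hpos.ne'))
    rw [abs_div, abs_of_pos hpos] at h1
    have h2 : 2 * frobNorm (W0 - Wstar) < |Zstar i j| / l2norm (fun i => Zstar i j) := by
      linarith
    rw [lt_div_iff₀ hpos] at h2
    have h3 := abs_sub_abs_le_abs_add (Zstar i j) (((W0 - Wstar) * P) i j)
    have h4 := herr i j
    rw [hmul]
    linarith
  have hthresh : ∀ j, (∀ i, Zstar i j ≠ 0 → Z1 i j = (W0 * P) i j) ∧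
      ∀ i, Zstar i j = 0 → Z1 i j = 0 := by
    intro j
    have h := (hZ1 j).eq_of_separated (hcols j) (by
      intro i hi k hk
      simp only [Finset.mem_filter, Finset.mem_univ, true_and, not_not] at hi hk
      refine lt_of_le_of_lt ?_ (hbig i j hi)
      simpa [hmul k j, hk] using herr k j)
    simpa using h
  refine ⟨fun j => ?_, ?_⟩
  · ext i
    refine ⟨fun h h0 => h ((hthresh j).2 i h0), fun h => ?_⟩
    rw [Set.mem_ofPred_eq, (hthresh j).1 i h, ← abs_pos]
    exact (mul_nonneg (frobNorm_nonneg _) (l2norm_nonneg _)).trans_lt (hbig i j h)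
  · calc frobNorm (Z1 - Zstar) ≤ frobNorm ((W0 - Wstar) * P) := by
          refine frobNorm_mono fun i j => ?_
          by_cases h : Zstar i j = 0
          · simp [h, (hthresh j).2 i h]
          · rw [Matrix.sub_apply, (hthresh j).1 i h, hmul, add_sub_cancel_left]
      _ ≤ frobNorm (W0 - Wstar) * specNorm P := frobNorm_mul_le _ _
      _ = frobNorm (W0 - Wstar) := by rw [hPnorm, mul_one]
end
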